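/- For every integer n ≥ 2, the space of sl_2-invariant linear maps ω: h_n → sch_n whose coboundary d¹ω vanishes identically on h_n has dimension n(n-1)/2 + 1. -/

import Mathlib

open scoped BigOperators

/-- Basis index set for the `n`-th Schrödinger algebra
`sch_n = span {h, e, f, x_1, …, x_n, y_1, …, y_n, z}`. -/
inductive SchIdx (n : ℕ) : Type
  | H : SchIdx n
  | E : SchIdx n
  | F : SchIdx n
  | X : Fin n → SchIdx n
  | Y : Fin n → SchIdx n
  | Z : SchIdx n
  deriving DecidableEq

/-- The underlying vector space of the `n`-th Schrödinger algebra. -/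
abbrev Sch (n : ℕ) : Type := SchIdx n → ℂ

/-- The Lie bracket of `sch_n`, written componentwise with respect to the basis;
it encodes exactly the relations `[e,f]=h, [h,e]=2e, [h,f]=-2f, [x_i,y_i]=z,
[h,x_i]=x_i, [h,y_i]=-y_i, [e,y_i]=x_i, [f,x_i]=y_i`. -/
noncomputable def br {n : ℕ} (u v : Sch n) : Sch n := fun j =>
  match j with
  | .H => u .E * v .F - u .F * v .E
  | .E => 2 * (u .H * v .E - u .E * v .H)
  | .F => -2 * (u .H * v .F - u .F * v .H)
  | .X i => (u .H * v (.X i) - u (.X i) * v .H) + (u .E * v (.Y i) - u (.Y i) * v .E)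
  | .Y i => -(u .H * v (.Y i) - u (.Y i) * v .H) + (u .F * v (.X i) - u (.X i) * v .F)
  | .Z => ∑ i : Fin n, (u (.X i) * v (.Y i) - u (.Y i) * v (.X i))

/-- The bracket of `sch_n` as a bilinear map. -/
noncomputable def brL (n : ℕ) : Sch n →ₗ[ℂ] Sch n →ₗ[ℂ] Sch n :=
  LinearMap.mk₂ ℂ br
    (by
      intro m m' v; funext j; cases j <;> simp only [br, Pi.add_apply]
      case Z => rw [← Finset.sum_add_distrib]; exact Finset.sum_congr rfl fun i _ => by ring
      all_goals ring)
    (by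
      intro c m v; funext j; cases j <;> simp only [br, Pi.smul_apply, smul_eq_mul]
      case Z => rw [Finset.mul_sum]; exact Finset.sum_congr rfl fun i _ => by ring
      all_goals ring)
    (by
      intro m v v'; funext j; cases j <;> simp only [br, Pi.add_apply]
      case Z => rw [← Finset.sum_add_distrib]; exact Finset.sum_congr rfl fun i _ => by ring
      all_goals ring)
    (by
      intro c m v; funext j; cases j <;> simp only [br, Pi.smul_apply, smul_eq_mul]
      case Z => rw [Finset.mul_sum]; exact Finset.sum_congr rfl fun i _ => by ring
      all_goals ring)

/-- The basis vector `h`. -/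
noncomputable def hV (n : ℕ) : Sch n := Pi.single SchIdx.H 1
/-- The basis vector `e`. -/
noncomputable def eV (n : ℕ) : Sch n := Pi.single SchIdx.E 1
/-- The basis vector `f`. -/
noncomputable def fV (n : ℕ) : Sch n := Pi.single SchIdx.F 1
/-- The central basis vector `z`. -/
noncomputable def zV (n : ℕ) : Sch n := Pi.single SchIdx.Z 1
/-- The basis vector `x_i`. -/
noncomputable def xV {n : ℕ} (i : Fin n) : Sch n := Pi.single (SchIdx.X i) 1
/-- The basis vector `y_i`. -/
noncomputable def yV {n : ℕ} (i : Fin n) : Sch n := Pi.single (SchIdx.Y i) 1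

/-- The subalgebra `sl_2 = span {e, f, h}` of `sch_n`. -/
noncomputable def sl2 (n : ℕ) : Submodule ℂ (Sch n) :=
  Submodule.span ℂ {eV n, fV n, hV n}
/-- Basis index set for the Heisenberg ideal `h_n = span {x_1, …, x_n, y_1, …, y_n, z}`. -/
inductive HIdx (n : ℕ) : Type
  | X : Fin n → HIdx n
  | Y : Fin n → HIdx n
  | Z : HIdx n
  deriving DecidableEq

/-- The underlying vector space of the Heisenberg ideal `h_n` of `sch_n`. -/
abbrev Heis (n : ℕ) : Type := HIdx n → ℂ

/-- The natural inclusion `h_n → sch_n`. -/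
noncomputable def ιH {n : ℕ} (a : Heis n) : Sch n := fun j =>
  match j with
  | .X i => a (.X i)
  | .Y i => a (.Y i)
  | .Z => a .Z
  | .H => 0
  | .E => 0
  | .F => 0

/-- The action of `v ∈ sch_n` on the ideal `h_n`: `act v a = [v, a]`, viewed inside `h_n`
(the ideal `h_n` is stable under taking brackets with any element). -/
noncomputable def act {n : ℕ} (v : Sch n) (a : Heis n) : Heis n := fun j =>
  match j with
  | .X i => brL n v (ιH a) (SchIdx.X i)
  | .Y i => brL n v (ιH a) (SchIdx.Y i)
  | .Z => brL n v (ιH a) SchIdx.Z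

/-- The bracket of the Heisenberg algebra `h_n`. -/
noncomputable def brH {n : ℕ} (a b : Heis n) : Heis n := act (ιH a) b

/-- The basis vector `x_i` of `h_n`. -/
noncomputable def xH {n : ℕ} (i : Fin n) : Heis n := Pi.single (HIdx.X i) 1
/-- The basis vector `y_i` of `h_n`. -/
noncomputable def yH {n : ℕ} (i : Fin n) : Heis n := Pi.single (HIdx.Y i) 1
/-- The basis vector `z` of `h_n`. -/
noncomputable def zH (n : ℕ) : Heis n := Pi.single HIdx.Z 1
/-- The space of `sl_2`-invariant linear maps `ω : h_n → sch_n` whose coboundary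
`d¹ω(a,b) = [ω(a),b] + [a,ω(b)] - ω([a,b])` vanishes identically on `h_n`. -/
noncomputable def invDer (n : ℕ) : Submodule ℂ (Heis n →ₗ[ℂ] Sch n) where
  carrier := {ω | (∀ v ∈ sl2 n, ∀ a, brL n v (ω a) = ω (act v a)) ∧
    ∀ a b, brL n (ω a) (ιH b) + brL n (ιH a) (ω b) - ω (brH a b) = 0}
  add_mem' := by
    rintro ω σ ⟨hω1, hω2⟩ ⟨hσ1, hσ2⟩
    refine ⟨fun v hv a => ?_, fun a b => ?_⟩
    · simp only [LinearMap.add_apply, map_add, hω1 v hv a, hσ1 v hv a]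
    · simp only [LinearMap.add_apply, map_add]
      linear_combination hω2 a b + hσ2 a b
  zero_mem' := ⟨fun v hv a => by simp, fun a b => by simp⟩
  smul_mem' := by
    rintro c ω ⟨hω1, hω2⟩
    refine ⟨fun v hv a => ?_, fun a b => ?_⟩
    · simp only [LinearMap.smul_apply, map_smul, hω1 v hv a]
    · simp only [LinearMap.smul_apply, map_smul]
      rw [← smul_add, ← smul_sub, hω2 a b, smul_zero]

open Matrix in
/-- The linear map `h_n → sch_n` acting by the matrix `A` on `x` and on `y`, and by `c` on `z`. -/
noncomputable def diagMap {n : ℕ} (A : Matrix (Fin n) (Fin n) ℂ) (c : ℂ) : Heis n →ₗ[ℂ] Sch n where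
  toFun a := fun j =>
    match j with
    | .X i => ((fun k => a (.X k)) ᵥ* A) i
    | .Y i => ((fun k => a (.Y k)) ᵥ* A) i
    | .Z => c * a .Z
    | .H => 0
    | .E => 0
    | .F => 0
  map_add' a b := by
    funext j
    cases j <;> simp [vecMul, dotProduct, add_mul, mul_add, Finset.sum_add_distrib]
  map_smul' r a := by
    funext j
    cases j <;> simp [vecMul, dotProduct, Finset.mul_sum, mul_assoc, mul_left_comm]

instance (n : ℕ) : Finite (HIdx n) :=
  Finite.of_surjective
    (fun s : Fin n ⊕ Fin n ⊕ Unit => s.elim HIdx.X fun t => t.elim HIdx.Y fun _ => HIdx.Z) (by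
      rintro (i | i | _)
      · exact ⟨.inl i, rfl⟩
      · exact ⟨.inr (.inl i), rfl⟩
      · exact ⟨.inr (.inr ()), rfl⟩)

lemma heis_linearMap_ext {n : ℕ} {ω σ : Heis n →ₗ[ℂ] Sch n}
    (hx : ∀ i, ω (xH i) = σ (xH i)) (hy : ∀ i, ω (yH i) = σ (yH i))
    (hz : ω (zH n) = σ (zH n)) : ω = σ := by
  classical
  refine LinearMap.pi_ext' fun i => LinearMap.ext_ring ?_
  cases i
  · exact hx _
  · exact hy _
  · exact hz

lemma brL_apply {n : ℕ} (u v : Sch n) : brL n u v = br u v := rfl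

section act
variable {n : ℕ} (i : Fin n)

lemma act_hV_xH : act (hV n) (xH i) = xH i := by
  funext j; cases j <;> simp [act, brL_apply, br, ιH, hV, xH, Pi.single_apply]

lemma act_hV_yH : act (hV n) (yH i) = -yH i := by
  funext j; cases j <;> simp [act, brL_apply, br, ιH, hV, yH, Pi.single_apply]

lemma act_hV_zH : act (hV n) (zH n) = 0 := by
  funext j; cases j <;> simp [act, brL_apply, br, ιH, hV, zH]

lemma act_eV_zH : act (eV n) (zH n) = 0 := by
  funext j; cases j <;> simp [act, brL_apply, br, ιH, eV, zH]

lemma act_fV_xH : act (fV n) (xH i) = yH i := by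
  funext j; cases j <;> simp [act, brL_apply, br, ιH, fV, xH, yH, Pi.single_apply]

lemma brH_xH_yH (j : Fin n) : brH (xH i) (yH j) = (if i = j then 1 else 0 : ℂ) • zH n := by
  funext k; cases k <;> simp [brH, act, brL_apply, br, ιH, xH, yH, zH, Pi.single_apply, eq_comm]

end act

section diagMap
variable {n : ℕ}

section entries
variable (A : Matrix (Fin n) (Fin n) ℂ) (c : ℂ)

lemma diagMap_xH (i j : Fin n) : diagMap A c (xH i) (.X j) = A i j := by
  simp [diagMap, xH, Matrix.vecMul, dotProduct, Pi.single_apply]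

lemma diagMap_yH (i j : Fin n) : diagMap A c (yH i) (.Y j) = A i j := by
  simp [diagMap, yH, Matrix.vecMul, dotProduct, Pi.single_apply]

lemma diagMap_zH : diagMap A c (zH n) .Z = c := by
  simp [diagMap, zH]

end entries

open Matrix in
lemma vecMul_dotProduct_add_dotProduct_vecMul {A : Matrix (Fin n) (Fin n) ℂ} {c : ℂ}
    (hA : A + Aᵀ = c • 1) (u v : Fin n → ℂ) :
    (u ᵥ* A) ⬝ᵥ v + u ⬝ᵥ (v ᵥ* A) = c * (u ⬝ᵥ v) := by
  rw [← dotProduct_mulVec, ← mulVec_transpose, ← dotProduct_add, ← add_mulVec, hA, smul_mulVec,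
    one_mulVec, dotProduct_smul, smul_eq_mul]

open Matrix in
lemma diagMap_mem_invDer {A : Matrix (Fin n) (Fin n) ℂ} {c : ℂ} (hA : A + Aᵀ = c • 1) :
    diagMap A c ∈ invDer n := by
  refine ⟨fun v hv a => ?_, fun a b => ?_⟩
  · suffices h : (∀ i, v (.X i) = 0) ∧ (∀ i, v (.Y i) = 0) by
      funext j
      cases j <;> simp [brL_apply, br, act, diagMap, ιH, h.1, h.2, vecMul, dotProduct,
        Finset.mul_sum, add_mul, Finset.sum_add_distrib, mul_assoc]
    induction hv using Submodule.span_induction with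
    | mem x hx =>
      rcases hx with rfl | rfl | rfl <;> simp [eV, fV, hV]
    | zero => simp
    | add x y _ _ hx hy => simp [hx, hy]
    | smul r x _ hx => simp [hx]
  · have h₀ : (fun _ : Fin n => (0 : ℂ)) ᵥ* A = 0 := zero_vecMul A
    funext j
    cases j <;> simp [brL_apply, br, brH, act, diagMap, ιH, h₀]
    have h₁ := vecMul_dotProduct_add_dotProduct_vecMul hA (fun k => a (.X k)) (fun k => b (.Y k))
    have h₂ := vecMul_dotProduct_add_dotProduct_vecMul hA (fun k => a (.Y k)) (fun k => b (.X k))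
    simp only [dotProduct] at h₁ h₂ ⊢
    linear_combination h₁ - h₂

end diagMap

section sl2
variable (n : ℕ)

lemma hV_mem_sl2 : hV n ∈ sl2 n := Submodule.subset_span (by simp)

lemma eV_mem_sl2 : eV n ∈ sl2 n := Submodule.subset_span (by simp)

lemma fV_mem_sl2 : fV n ∈ sl2 n := Submodule.subset_span (by simp)

end sl2

open Matrix in
lemma eq_diagMap_of_mem_invDer {n : ℕ} {ω : Heis n →ₗ[ℂ] Sch n} (hω : ω ∈ invDer n) :
    ∃ (A : Matrix (Fin n) (Fin n) ℂ) (c : ℂ), A + Aᵀ = c • 1 ∧ ω = diagMap A c := by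
  obtain ⟨hinv, hcob⟩ := hω
  set A : Matrix (Fin n) (Fin n) ℂ := Matrix.of fun i j => ω (xH i) (.X j) with hA
  have hx (i : Fin n) : ω (xH i) = diagMap A (ω (zH n) .Z) (xH i) := by
    have h := hinv _ (hV_mem_sl2 n) (xH i)
    rw [act_hV_xH] at h
    funext j
    have hj := congrFun h j
    cases j <;> simp [brL_apply, br, hV] at hj
    case X j => simp [diagMap_xH, hA]
    all_goals
      trans 0
      · grind
      · simp [diagMap, xH, vecMul, dotProduct]
  have hy (i : Fin n) : ω (yH i) = diagMap A (ω (zH n) .Z) (yH i) := by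
    have h := hinv _ (hV_mem_sl2 n) (yH i)
    have h' := hinv _ (fV_mem_sl2 n) (xH i)
    rw [act_hV_yH, map_neg] at h
    rw [act_fV_xH] at h'
    funext j
    have hj := congrFun h j
    have hj' := congrFun h' j
    cases j <;> simp [brL_apply, br, hV, fV] at hj hj'
    case Y j => simp [diagMap_yH, hA, hj']
    all_goals
      trans 0
      · grind
      · simp [diagMap, yH, vecMul, dotProduct]
  have hz : ω (zH n) = diagMap A (ω (zH n) .Z) (zH n) := by
    have h := hinv _ (hV_mem_sl2 n) (zH n)
    have h' := hinv _ (eV_mem_sl2 n) (zH n)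
    rw [act_hV_zH, map_zero] at h
    rw [act_eV_zH, map_zero] at h'
    funext j
    have hj := congrFun h j
    have hE := congrFun h' .E
    cases j <;> simp [brL_apply, br, hV, eV] at hj hE
    case Z => simp [diagMap_zH]
    all_goals
      trans 0
      · grind
      · simp [diagMap, zH, vecMul, dotProduct]
  refine ⟨A, ω (zH n) .Z, ?_, heis_linearMap_ext hx hy hz⟩
  ext i j
  have h := congrFun (hcob (xH i) (yH j)) .Z
  rw [brH_xH_yH, hx, hy, map_smul] at h
  simp only [brL_apply, br, ιH, Pi.sub_apply, Pi.add_apply, Pi.smul_apply, diagMap_xH, diagMap_yH,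
    Pi.zero_apply] at h
  simp [xH, yH, Pi.single_apply] at h
  simp [Matrix.one_apply]
  linear_combination h

/-- The strictly upper triangular part of the matrix of `ω` on the `x_i`, together with its
coefficient on `z`. -/
noncomputable def invDerCoords (n : ℕ) :
    invDer n →ₗ[ℂ] ((j : Fin n) → Fin j → ℂ) × ℂ where
  toFun ω := (fun j i => ω.1 (xH (i.castLE j.2.le)) (.X j), ω.1 (zH n) .Z)
  map_add' _ _ := rfl
  map_smul' _ _ := rfl

lemma invDerCoords_injective (n : ℕ) : Function.Injective (invDerCoords n) := by
  rw [injective_iff_map_eq_zero]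
  rintro ⟨ω, hω⟩ h
  obtain ⟨A, c, hA, rfl⟩ := eq_diagMap_of_mem_invDer hω
  obtain ⟨h₁, h₂⟩ := Prod.ext_iff.1 h
  have hc : c = 0 := by simpa [invDerCoords, diagMap_zH] using h₂
  have hlt (i j : Fin n) (hij : i < j) : A i j = 0 := by
    simpa [invDerCoords, diagMap_xH] using congrFun (congrFun h₁ j) ⟨i, hij⟩
  have hskew (i j : Fin n) : A i j + A j i = 0 := by
    simpa [hc] using congrFun (congrFun hA i) j
  have hA0 : A = 0 := by
    ext i j
    have := hskew i j
    rcases lt_trichotomy i j with hij | rfl | hij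
    · exact hlt i j hij
    · simpa using this
    · simpa [hlt j i hij] using this
  ext a j
  cases j <;> simp [diagMap, hA0, hc]

lemma invDerCoords_surjective (n : ℕ) : Function.Surjective (invDerCoords n) := by
  rintro ⟨u, c⟩
  let A : Matrix (Fin n) (Fin n) ℂ := Matrix.of fun i j =>
    if h : i < j then u j ⟨i, h⟩ else if h : j < i then -u i ⟨j, h⟩ else c / 2
  have hA : A + A.transpose = c • 1 := by
    ext i j
    rcases lt_trichotomy i j with hij | rfl | hij
    · simp [A, hij, hij.not_gt, hij.ne]
    · simp [A]
    · simp [A, hij, hij.not_gt, hij.ne']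
  refine ⟨⟨diagMap A c, diagMap_mem_invDer hA⟩, Prod.ext ?_ (diagMap_zH A c)⟩
  funext j i
  have hij : i.castLE j.2.le < j := i.2
  simp [invDerCoords, diagMap_xH, A, hij]

/-- **For every `n ≥ 2`, the space of `sl_2`-invariant linear maps `ω : h_n → sch_n` with
vanishing coboundary has dimension `n(n-1)/2 + 1`.** -/
theorem dim_invDer (n : ℕ) (hn : 2 ≤ n) :
    Module.finrank ℂ ↥(invDer n) = n * (n - 1) / 2 + 1 := by
  rw [(LinearEquiv.ofBijective (invDerCoords n)
    ⟨invDerCoords_injective n, invDerCoords_surjective n⟩).finrank_eq]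
  simp [Module.finrank_pi_fintype, Fin.sum_univ_eq_sum_range (fun i => i), Finset.sum_range_id]
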